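/- arXiv:1912.10200 — 2 statements merged into one kernel-verified Lean document; each statement's English description precedes it below -/
import Mathlib

section
/- Let q̃ be a probability measure on ℝ with finite second moment, mean μ_{q̃}, and quantile function F_{q̃}⁻¹. The unique minimizer (μ*, σ*) of (μ,σ) ↦ W₂²(q̃, N(μ,σ²)) over μ ∈ ℝ, σ > 0 satisfies μ* = μ_{q̃} and σ* = √2 ∫₀¹ F_{q̃}⁻¹(y) erf⁻¹(2y−1) dy. -/
open MeasureTheory ProbabilityTheory Set

/-- `Wpp p ξ ν` : the `p`-th power of the `L_p` Wasserstein distance, as the infimum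
over couplings `π` of `ξ` and `ν` of `∫ |x - z|^p dπ(x, z)`. -/
noncomputable def Wpp (p : ℝ) (ξ ν : Measure ℝ) : ℝ :=
  sInf {c : ℝ | ∃ π : Measure (ℝ × ℝ), IsProbabilityMeasure π ∧
    π.map Prod.fst = ξ ∧ π.map Prod.snd = ν ∧ c = ∫ z, |z.1 - z.2| ^ p ∂π}

/-- Quantile function: `F⁻¹(y) = inf {x : F(x) ≥ y}` where `F(x) = ξ((-∞, x])`. -/
noncomputable def quantile (ξ : Measure ℝ) (y : ℝ) : ℝ :=
  sInf {x : ℝ | y ≤ (ξ (Iic x)).toReal}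

/-- The error function `erf(x) = (2/√π) ∫₀ˣ e^{-t²} dt`. -/
noncomputable def erf (x : ℝ) : ℝ :=
  (2 / Real.sqrt Real.pi) * ∫ t in (0:ℝ)..x, Real.exp (-t ^ 2)

/-- The inverse error function. -/
noncomputable def erfinv : ℝ → ℝ := Function.invFun erf


lemma phi_sub {T : ℝ → ℝ} (hT : Monotone T) (z q : ℝ) :
    T z * (q - z) ≤ ∫ t in z..q, T t := by
  rcases le_total z q with h | h
  · have := intervalIntegral.integral_mono_on (μ := volume) (f := fun _ => T z) (g := T) h
      (by simp) hT.intervalIntegrable (fun x hx => hT hx.1)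
    simp at this
    linarith
  · have := intervalIntegral.integral_mono_on (μ := volume) (f := T) (g := fun _ => T z) h
      hT.intervalIntegrable (by simp) (fun x hx => hT hx.2)
    rw [intervalIntegral.integral_symm]
    simp at this
    linarith

lemma duality (γ : Measure ℝ) [IsProbabilityMeasure γ] (T : ℝ → ℝ) (hT : Monotone T)
    (h1 : MemLp (fun z : ℝ => z) 2 γ) (h2 : MemLp T 2 γ)
    (π : Measure (ℝ × ℝ)) [IsProbabilityMeasure π]
    (hf : π.map Prod.fst = γ.map T) (hs : π.map Prod.snd = γ) :
    ∫ p, p.1 * p.2 ∂π ≤ ∫ z, T z * z ∂γ := by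
  set φ : ℝ → ℝ := fun z => ∫ t in (0:ℝ)..z, T t with hφ
  have hint : ∀ a b, IntervalIntegrable T volume a b := fun a b => hT.intervalIntegrable
  have hφc : Continuous φ := intervalIntegral.continuous_primitive (fun a b => hint a b) 0
  have hφs : ∀ z q, T z * (q - z) ≤ φ q - φ z := by
    intro z q
    have := phi_sub hT z q
    rw [hφ]
    simp only
    rw [intervalIntegral.integral_interval_sub_left (hint _ _) (hint _ _)]
    exact this
  have hTm : Measurable T := hT.measurable
  have hTz : Integrable (fun z => T z * z) γ := h2.integrable_mul h1
  have hφi : Integrable φ γ := by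
    have hb : Integrable (fun z => |T z * z| + |T 0 * z|) γ :=
      hTz.abs.add ((h1.integrable (by norm_num)).const_mul _).abs
    refine hb.mono' hφc.aestronglyMeasurable (ae_of_all _ fun z => ?_)
    have a := hφs 0 z
    have b := hφs z 0
    have h0 : φ 0 = 0 := by simp [hφ]
    rw [h0] at a b
    rw [Real.norm_eq_abs, abs_le]
    have := neg_abs_le (T 0 * z)
    have := le_abs_self (T z * z)
    have := abs_nonneg (T 0 * z)
    have := abs_nonneg (T z * z)
    constructor <;> linarith
  set f : ℚ → ℝ → ℝ := fun q x => x * q - φ q with hfdef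
  have hfm : ∀ q, Measurable (f q) := fun q => by fun_prop
  set ψ : ℝ → ℝ := fun x => ⨆ q, f q x with hψ
  have hψm : Measurable ψ := Measurable.iSup hfm
  set B : Set ℝ := {x | BddAbove (range fun q => f q x)} with hB
  have hBm : MeasurableSet B := measurableSet_bddAbove_range hfm
  have hTub : ∀ z q, f q (T z) ≤ T z * z - φ z := by
    intro z q
    have := hφs z q
    simp only [hfdef]
    linarith
  have hTB : ∀ z, T z ∈ B := by
    intro z
    refine ⟨T z * z - φ z, ?_⟩
    rintro _ ⟨q, rfl⟩
    exact hTub z q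
  have hyoung : ∀ x ∈ B, ∀ z, x * z - φ z ≤ ψ x := by
    intro x hx z
    have hcl : IsClosed {z : ℝ | x * z - φ z ≤ ψ x} :=
      isClosed_le (by fun_prop) continuous_const
    have : closure (range ((↑) : ℚ → ℝ)) ⊆ {z : ℝ | x * z - φ z ≤ ψ x} := by
      apply hcl.closure_subset_iff.2
      rintro _ ⟨q, rfl⟩
      exact le_ciSup (f := fun q => f q x) hx q
    rw [Rat.denseRange_cast.closure_range] at this
    exact this (mem_univ z)
  have hψT : ∀ z, ψ (T z) = T z * z - φ z := by
    intro z
    exact le_antisymm (ciSup_le (hTub z)) (hyoung _ (hTB z) z)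
  have hψi : Integrable (fun z => ψ (T z)) γ := by
    simp_rw [hψT]
    exact hTz.sub hφi
  have hψi' : Integrable (fun p : ℝ × ℝ => ψ p.1) π := by
    have : Integrable ψ (π.map Prod.fst) := by
      rw [hf]
      exact (integrable_map_measure hψm.aestronglyMeasurable hTm.aemeasurable).2 hψi
    exact (integrable_map_measure hψm.aestronglyMeasurable measurable_fst.aemeasurable).1 this
  have hφi' : Integrable (fun p : ℝ × ℝ => φ p.2) π := by
    have : Integrable φ (π.map Prod.snd) := by rwa [hs]
    exact (integrable_map_measure hφc.aestronglyMeasurable measurable_snd.aemeasurable).1 this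
  have hx2 : MemLp (fun p : ℝ × ℝ => p.1) 2 π := by
    have : MemLp (fun z : ℝ => z) 2 (π.map Prod.fst) := by
      rw [hf]
      exact (memLp_map_measure_iff (by fun_prop) hTm.aemeasurable).2 h2
    exact (memLp_map_measure_iff (by fun_prop) measurable_fst.aemeasurable).1 this
  have hz2 : MemLp (fun p : ℝ × ℝ => p.2) 2 π := by
    have : MemLp (fun z : ℝ => z) 2 (π.map Prod.snd) := by rwa [hs]
    exact (memLp_map_measure_iff (by fun_prop) measurable_snd.aemeasurable).1 this
  have hae : ∀ᵐ p ∂π, p.1 ∈ B := by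
    have : ∀ᵐ x ∂(π.map Prod.fst), x ∈ B := by
      rw [hf]
      exact (ae_map_iff hTm.aemeasurable hBm).2 (ae_of_all _ hTB)
    exact (ae_map_iff measurable_fst.aemeasurable hBm).1 this
  calc ∫ p, p.1 * p.2 ∂π ≤ ∫ p, ψ p.1 + φ p.2 ∂π := by
        refine integral_mono_ae (hx2.integrable_mul hz2) (hψi'.add hφi') ?_
        filter_upwards [hae] with p hp
        have := hyoung p.1 hp p.2
        linarith
    _ = ∫ p, ψ p.1 ∂π + ∫ p, φ p.2 ∂π := integral_add hψi' hφi'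
    _ = ∫ z, ψ (T z) ∂γ + ∫ z, φ z ∂γ := by
        congr 1
        · rw [← integral_map (f := ψ) measurable_fst.aemeasurable hψm.aestronglyMeasurable, hf,
            integral_map hTm.aemeasurable hψm.aestronglyMeasurable]
        · rw [← integral_map (f := φ) measurable_snd.aemeasurable hφc.aestronglyMeasurable, hs]
    _ = ∫ z, T z * z ∂γ := by
        rw [← integral_add hψi hφi]
        congr 1
        ext z
        rw [hψT]
        ring

open Filter Topology in
lemma erf_neg' (x : ℝ) : erf (-x) = - erf x := by
  unfold erf
  have := intervalIntegral.integral_comp_neg (a := 0) (b := x) (fun t : ℝ => Real.exp (-t^2))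
  simp only [neg_zero, neg_sq] at this
  rw [this, intervalIntegral.integral_symm]
  ring

lemma erf_hasDeriv (x : ℝ) : HasDerivAt erf (2 / Real.sqrt Real.pi * Real.exp (-x^2)) x := by
  unfold erf
  apply HasDerivAt.const_mul
  have hc : Continuous (fun t : ℝ => Real.exp (-t^2)) := by fun_prop
  exact (hc.integral_hasStrictDerivAt 0 x).hasDerivAt

lemma erf_strictMono : StrictMono erf := by
  apply strictMono_of_hasDerivAt_pos (fun x => erf_hasDeriv x)
  intro x
  positivity

open Filter Topology in
lemma erf_top : Tendsto erf atTop (𝓝 1) := by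
  have h1 : IntegrableOn (fun t : ℝ => Real.exp (-t^2)) (Ioi 0) := by
    have := (integrable_exp_neg_mul_sq (b := 1) one_pos).integrableOn (s := Ioi 0)
    simpa using this
  have h := intervalIntegral_tendsto_integral_Ioi 0 h1 tendsto_id
  have e : ∫ t in Ioi (0:ℝ), Real.exp (-t^2) = Real.sqrt Real.pi / 2 := by
    have := integral_gaussian_Ioi 1
    simpa using this
  rw [e] at h
  have := h.const_mul (2 / Real.sqrt Real.pi)
  have e2 : 2 / Real.sqrt Real.pi * (Real.sqrt Real.pi / 2) = 1 := by
    have : Real.sqrt Real.pi ≠ 0 := by positivity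
    field_simp
  rw [e2] at this
  exact this

open Filter Topology in
lemma erf_bot : Tendsto erf atBot (𝓝 (-1)) := by
  have := (erf_top.comp tendsto_neg_atBot_atTop).neg
  refine this.congr fun x => ?_
  simp [erf_neg']

lemma erfinv_erf (x : ℝ) : erfinv (erf x) = x :=
  Function.leftInverse_invFun erf_strictMono.injective x

noncomputable def Phi (z : ℝ) : ℝ := (1 + erf (z / Real.sqrt 2)) / 2

lemma erfinv_Phi (z : ℝ) : Real.sqrt 2 * erfinv (2 * Phi z - 1) = z := by
  have : 2 * Phi z - 1 = erf (z / Real.sqrt 2) := by unfold Phi; ring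
  rw [this, erfinv_erf]
  field_simp

lemma Phi_hasDeriv (z : ℝ) : HasDerivAt Phi (gaussianPDFReal 0 1 z) z := by
  have h := (((erf_hasDeriv (z / Real.sqrt 2)).comp z
    ((hasDerivAt_id z).div_const (Real.sqrt 2))).const_add 1).div_const 2
  refine h.congr_deriv ?_
  rw [gaussianPDFReal]
  have e : (z / Real.sqrt 2)^2 = z^2/2 := by rw [div_pow]; simp
  have hp : Real.sqrt Real.pi ≠ 0 := by positivity
  rw [e]
  simp only [NNReal.coe_one, mul_one, sub_zero, Nat.ofNat_nonneg, Real.sqrt_mul, neg_div]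
  field_simp

lemma Phi_strictMono : StrictMono Phi :=
  strictMono_of_hasDerivAt_pos Phi_hasDeriv (fun x => gaussianPDFReal_pos _ _ _ one_ne_zero)

open Filter Topology in
lemma Phi_top : Tendsto Phi atTop (𝓝 1) := by
  have h := ((erf_top.comp (tendsto_id.atTop_div_const
    (show (0:ℝ) < Real.sqrt 2 by positivity))).const_add 1).div_const 2
  norm_num at h
  exact h

open Filter Topology in
lemma Phi_bot : Tendsto Phi atBot (𝓝 0) := by
  have h := ((erf_bot.comp (tendsto_id.atBot_div_const
    (show (0:ℝ) < Real.sqrt 2 by positivity))).const_add 1).div_const 2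
  norm_num at h
  exact h

lemma Phi_cont : Continuous Phi :=
  continuous_iff_continuousAt.2 fun z => (Phi_hasDeriv z).continuousAt

lemma Phi_lt (z : ℝ) : Phi z < 1 :=
  (Phi_strictMono (lt_add_one z)).trans_le (Phi_strictMono.monotone.ge_of_tendsto Phi_top _)

lemma Phi_pos (z : ℝ) : 0 < Phi z :=
  (Phi_strictMono.monotone.le_of_tendsto Phi_bot _).trans_lt (Phi_strictMono (sub_one_lt z))

lemma Phi_range : range Phi = Ioo 0 1 := by
  apply Subset.antisymm
  · rintro _ ⟨z, rfl⟩
    exact ⟨Phi_pos z, Phi_lt z⟩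
  · rintro y ⟨h0, h1⟩
    obtain ⟨a, ha⟩ := (Phi_bot.eventually_lt_const h0).exists
    obtain ⟨b, hb⟩ := (Phi_top.eventually_const_lt h1).exists
    exact mem_range_of_exists_le_of_exists_ge Phi_cont ⟨a, ha.le⟩ ⟨b, hb.le⟩

lemma gauss_Iic (z : ℝ) : gaussianReal 0 1 (Iic z) = ENNReal.ofReal (Phi z) := by
  rw [gaussianReal_apply_eq_integral _ one_ne_zero]
  rw [integral_Iic_of_hasDerivAt_of_tendsto' (fun x _ => Phi_hasDeriv x)
    (integrable_gaussianPDFReal 0 1).integrableOn Phi_bot]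
  simp

lemma change_var (g : ℝ → ℝ) :
    ∫ y in (0:ℝ)..1, g y = ∫ z, g (Phi z) ∂(gaussianReal 0 1) := by
  rw [intervalIntegral.integral_of_le zero_le_one, integral_Ioc_eq_integral_Ioo,
    ← Phi_range, ← image_univ, integral_image_eq_integral_abs_deriv_smul MeasurableSet.univ
      (fun x _ => (Phi_hasDeriv x).hasDerivWithinAt) Phi_strictMono.injective.injOn,
    integral_gaussianReal_eq_integral_smul one_ne_zero]
  simp only [Measure.restrict_univ]
  congr 1
  ext z
  rw [abs_of_nonneg (gaussianPDFReal_nonneg _ _ _)]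

section
variable (qt : Measure ℝ) [IsProbabilityMeasure qt]

open Filter Topology in
lemma quantile_le_iff {y : ℝ} (h0 : 0 < y) (h1 : y < 1) (x : ℝ) :
    quantile qt y ≤ x ↔ y ≤ cdf qt x := by
  have hS : {x : ℝ | y ≤ (qt (Iic x)).toReal} = {x | y ≤ cdf qt x} := by
    ext x
    simp [cdf_eq_real, Measure.real]
  have hne : {x : ℝ | y ≤ cdf qt x}.Nonempty := by
    obtain ⟨b, hb⟩ := ((tendsto_cdf_atTop qt).eventually_const_lt h1).exists
    exact ⟨b, hb.le⟩
  have hbd : BddBelow {x : ℝ | y ≤ cdf qt x} := by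
    obtain ⟨a, ha⟩ := ((tendsto_cdf_atBot qt).eventually_lt_const h0).exists
    refine ⟨a, fun x hx => ?_⟩
    by_contra! hlt
    have := monotone_cdf qt hlt.le
    replace hx : y ≤ cdf qt x := hx
    linarith
  unfold quantile
  rw [hS]
  constructor
  · intro h
    have hc : Tendsto (cdf qt) (𝓝[>] x) (𝓝 (cdf qt x)) :=
      ((cdf qt).right_continuous x).tendsto.mono_left (nhdsWithin_mono _ Ioi_subset_Ici_self)
    refine ge_of_tendsto hc ?_
    filter_upwards [self_mem_nhdsWithin] with w hw
    obtain ⟨a, ha, haw⟩ := exists_lt_of_csInf_lt hne (lt_of_le_of_lt h hw)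
    exact le_trans ha (monotone_cdf qt haw.le)
  · intro h
    exact csInf_le hbd h

lemma quantile_mono {y y' : ℝ} (h0 : 0 < y) (h : y ≤ y') (h1 : y' < 1) :
    quantile qt y ≤ quantile qt y' := by
  rw [quantile_le_iff qt h0 (h.trans_lt h1)]
  exact h.trans ((quantile_le_iff qt (h0.trans_le h) h1 _).1 le_rfl)

lemma T_mono : Monotone (fun z => quantile qt (Phi z)) := fun a b h =>
  quantile_mono qt (Phi_pos a) (Phi_strictMono.monotone h) (Phi_lt b)

lemma T_map : (gaussianReal 0 1).map (fun z => quantile qt (Phi z)) = qt := by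
  have hm := (T_mono qt).measurable
  have := Measure.isProbabilityMeasure_map (μ := gaussianReal 0 1) hm.aemeasurable
  refine Measure.ext_of_Iic _ _ fun x => ?_
  rw [Measure.map_apply hm measurableSet_Iic, ← ofReal_cdf]
  have hpre : (fun z => quantile qt (Phi z)) ⁻¹' Iic x = {z | Phi z ≤ cdf qt x} := by
    ext z
    exact quantile_le_iff qt (Phi_pos z) (Phi_lt z) x
  rw [hpre]
  rcases (cdf_nonneg qt x).eq_or_lt with h | h
  · rw [← h]
    have : {z | Phi z ≤ 0} = ∅ := by
      ext z; simpa using Phi_pos z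
    simp [this]
  rcases (cdf_le_one qt x).eq_or_lt with h' | h'
  · rw [h']
    have : {z | Phi z ≤ 1} = univ := by
      ext z; simpa using (Phi_lt z).le
    simp [this]
  have : cdf qt x ∈ range Phi := by rw [Phi_range]; exact ⟨h, h'⟩
  obtain ⟨w, hw⟩ := this
  rw [← hw, ← gauss_Iic]
  congr 1
  ext z
  exact Phi_strictMono.le_iff_le

end

lemma gauss_aff (m σ : ℝ) :
    (gaussianReal 0 1).map (fun z => m + σ * z) = gaussianReal m ((σ^2).toNNReal) := by
  have h := gaussianReal_map_const_mul (μ := 0) (v := 1) σ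
  have h2 := gaussianReal_map_const_add (μ := 0) (v := (σ^2).toNNReal) m
  have e : NNReal.mk (σ^2) (sq_nonneg σ) * 1 = (σ^2).toNNReal := by
    ext; simp [sq_nonneg]
  rw [mul_zero, e] at h
  rw [← h, Measure.map_map (by fun_prop) (by fun_prop)] at h2
  simpa [Function.comp_def] using h2

lemma gauss_aff_inv (m σ : ℝ) (hσ : 0 < σ) :
    (gaussianReal m ((σ^2).toNNReal)).map (fun z => (z - m) / σ) = gaussianReal 0 1 := by
  rw [← gauss_aff, Measure.map_map (by fun_prop) (by fun_prop)]
  have : (fun z => (z - m) / σ) ∘ (fun z => m + σ * z) = id := by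
    ext z
    simp only [Function.comp_apply, id]
    field_simp
    ring
  rw [this, Measure.map_id]

lemma gauss_L2 : MemLp (fun z : ℝ => z) 2 (gaussianReal 0 1) :=
  memLp_id_gaussianReal' 2 (by norm_num)

lemma gauss_sq : ∫ z, z^2 ∂(gaussianReal 0 1) = 1 := by
  have h := variance_id_gaussianReal (μ := 0) (v := 1)
  rw [variance_eq_integral (by fun_prop)] at h
  simpa using h

/-- cost expansion -/
lemma cost_eq {Ω : Type*} [MeasurableSpace Ω] (P : Measure Ω) [IsProbabilityMeasure P]
    (X W : Ω → ℝ) (hX : MemLp X 2 P) (hW : MemLp W 2 P) (m σ : ℝ)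
    (hW0 : ∫ ω, W ω ∂P = 0) (hW1 : ∫ ω, W ω ^ 2 ∂P = 1) :
    ∫ ω, (X ω - (m + σ * W ω)) ^ 2 ∂P =
      ∫ ω, X ω ^ 2 ∂P - 2 * m * ∫ ω, X ω ∂P - 2 * σ * ∫ ω, X ω * W ω ∂P + m ^ 2 + σ ^ 2 := by
  have i1 : Integrable X P := hX.integrable (by norm_num)
  have i2 : Integrable W P := hW.integrable (by norm_num)
  have i3 : Integrable (fun ω => X ω * W ω) P := hX.integrable_mul hW
  have i4 : Integrable (fun ω => X ω ^ 2) P := hX.integrable_sq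
  have i5 : Integrable (fun ω => W ω ^ 2) P := hW.integrable_sq
  have e : ∀ ω, (X ω - (m + σ * W ω)) ^ 2 = X ω ^ 2 + (-2 * m) * X ω + (-2 * σ) * (X ω * W ω)
      + (2 * m * σ) * W ω + σ ^ 2 * W ω ^ 2 + m ^ 2 := fun ω => by ring
  simp_rw [e]
  have j1 := i1.const_mul (-2 * m)
  have j3 := i3.const_mul (-2 * σ)
  have j2 := i2.const_mul (2 * m * σ)
  have j5 := i5.const_mul (σ ^ 2)
  have k1 : Integrable (fun ω => X ω ^ 2 + (-2 * m) * X ω) P := i4.add j1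
  have k2 : Integrable (fun ω => X ω ^ 2 + (-2 * m) * X ω + (-2 * σ) * (X ω * W ω)) P :=
    k1.add j3
  have k3 : Integrable (fun ω => X ω ^ 2 + (-2 * m) * X ω + (-2 * σ) * (X ω * W ω)
      + (2 * m * σ) * W ω) P := k2.add j2
  have k4 : Integrable (fun ω => X ω ^ 2 + (-2 * m) * X ω + (-2 * σ) * (X ω * W ω)
      + (2 * m * σ) * W ω + σ ^ 2 * W ω ^ 2) P := k3.add j5
  rw [integral_add k4 (integrable_const _), integral_add k3 j5, integral_add k2 j2,
    integral_add k1 j3, integral_add i4 j1]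
  simp only [integral_const_mul, hW0, hW1]
  simp
  ring

lemma Wpp_formula (qt : Measure ℝ) [IsProbabilityMeasure qt]
    (hmom : Integrable (fun x => x ^ 2) qt) (m σ : ℝ) (hσ : 0 < σ) :
    Wpp 2 qt (gaussianReal m ((σ ^ 2).toNNReal)) =
      ∫ x, x ^ 2 ∂qt - 2 * m * ∫ x, x ∂qt -
        2 * σ * ∫ z, quantile qt (Phi z) * z ∂(gaussianReal 0 1) + m ^ 2 + σ ^ 2 := by
  have hq2 : MemLp (fun x : ℝ => x) 2 qt := (memLp_two_iff_integrable_sq (by fun_prop)).2 hmom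
  set T : ℝ → ℝ := fun z => quantile qt (Phi z) with hT
  have hTm : Monotone T := T_mono qt
  have hTmap : (gaussianReal 0 1).map T = qt := T_map qt
  have hTL : MemLp T 2 (gaussianReal 0 1) := by
    rw [← hTmap] at hq2
    exact (memLp_map_measure_iff (by fun_prop) hTm.measurable.aemeasurable).1 hq2
  unfold Wpp
  refine IsLeast.csInf_eq ⟨?_, ?_⟩
  · have hm : Measurable (fun z => (T z, m + σ * z)) := hTm.measurable.prodMk (by fun_prop)
    refine ⟨(gaussianReal 0 1).map (fun z => (T z, m + σ * z)),
      Measure.isProbabilityMeasure_map hm.aemeasurable, ?_, ?_, ?_⟩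
    · rw [Measure.map_map measurable_fst hm]
      exact hTmap
    · rw [Measure.map_map measurable_snd hm]
      exact gauss_aff m σ
    · simp only [Real.rpow_ofNat, sq_abs]
      rw [integral_map hm.aemeasurable (by fun_prop)]
      simp only
      rw [cost_eq _ T (fun z => z) hTL gauss_L2 m σ integral_id_gaussianReal gauss_sq]
      rw [← hTmap, integral_map hTm.measurable.aemeasurable (by fun_prop),
        integral_map hTm.measurable.aemeasurable (by fun_prop), hTmap]
  · rintro c ⟨π, hπ, h1, h2, rfl⟩
    simp only [Real.rpow_ofNat, sq_abs]
    have hX : MemLp (fun p : ℝ × ℝ => p.1) 2 π := by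
      rw [← h1] at hq2
      exact (memLp_map_measure_iff (by fun_prop) measurable_fst.aemeasurable).1 hq2
    have hWmap : π.map (fun p => (p.2 - m) / σ) = gaussianReal 0 1 := by
      rw [← gauss_aff_inv m σ hσ, ← h2, Measure.map_map (by fun_prop) (by fun_prop)]
      rfl
    have hWmeas : Measurable (fun p : ℝ × ℝ => (p.2 - m) / σ) := by fun_prop
    have hW : MemLp (fun p : ℝ × ℝ => (p.2 - m) / σ) 2 π := by
      have := gauss_L2
      rw [← hWmap] at this
      exact (memLp_map_measure_iff (by fun_prop) hWmeas.aemeasurable).1 this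
    have hW0 : ∫ p, (p.2 - m) / σ ∂π = 0 := by
      have := integral_id_gaussianReal (μ := 0) (v := 1)
      rw [← hWmap, integral_map hWmeas.aemeasurable (by fun_prop)] at this
      exact this
    have hW1 : ∫ p, ((p.2 - m) / σ) ^ 2 ∂π = 1 := by
      have := gauss_sq
      rw [← hWmap, integral_map hWmeas.aemeasurable (by fun_prop)] at this
      exact this
    have key := cost_eq π _ _ hX hW m σ hW0 hW1
    have e : ∀ p : ℝ × ℝ, p.1 - (m + σ * ((p.2 - m) / σ)) = p.1 - p.2 := fun p => by
      field_simp
      ring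
    simp_rw [e] at key
    rw [key]
    have m1 : ∫ p, p.1 ∂π = ∫ x, x ∂qt := by
      rw [← h1, integral_map measurable_fst.aemeasurable (by fun_prop)]
    have m2 : ∫ p, p.1 ^ 2 ∂π = ∫ x, x ^ 2 ∂qt := by
      rw [← h1, integral_map measurable_fst.aemeasurable (by fun_prop)]
    rw [m1, m2]
    have hm : Measurable (fun p : ℝ × ℝ => (p.1, (p.2 - m) / σ)) := by fun_prop
    have hpr := Measure.isProbabilityMeasure_map (μ := π) hm.aemeasurable
    have hd := duality (gaussianReal 0 1) T hTm gauss_L2 hTL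
      (π.map (fun p => (p.1, (p.2 - m) / σ)))
      (by rw [Measure.map_map measurable_fst hm, hTmap]; exact h1)
      (by rw [Measure.map_map measurable_snd hm]; exact hWmap)
    rw [integral_map hm.aemeasurable (by fun_prop)] at hd
    simp only at hd
    have := mul_le_mul_of_nonneg_left hd hσ.le
    linarith

lemma S_pos (qt : Measure ℝ) [IsProbabilityMeasure qt]
    (hmom : Integrable (fun x => x ^ 2) qt) (hnd : ∀ x : ℝ, qt ≠ Measure.dirac x) :
    0 < ∫ z, quantile qt (Phi z) * z ∂(gaussianReal 0 1) := by
  have hq2 : MemLp (fun x : ℝ => x) 2 qt := (memLp_two_iff_integrable_sq (by fun_prop)).2 hmom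
  set T : ℝ → ℝ := fun z => quantile qt (Phi z) with hT
  have hTm : Monotone T := T_mono qt
  have hTmap : (gaussianReal 0 1).map T = qt := T_map qt
  have hTL : MemLp T 2 (gaussianReal 0 1) := by
    rw [← hTmap] at hq2
    exact (memLp_map_measure_iff (by fun_prop) hTm.measurable.aemeasurable).1 hq2
  have i1 : Integrable (fun z => T z * z) (gaussianReal 0 1) := hTL.integrable_mul gauss_L2
  have i2 : Integrable (fun z => T 0 * z) (gaussianReal 0 1) :=
    (gauss_L2.integrable (by norm_num)).const_mul _
  have e : ∫ z, T z * z ∂(gaussianReal 0 1) = ∫ z, (T z * z - T 0 * z) ∂(gaussianReal 0 1) := by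
    rw [integral_sub i1 i2, integral_const_mul, integral_id_gaussianReal]
    simp
  have hnn : ∀ z, 0 ≤ T z * z - T 0 * z := by
    intro z
    rw [← sub_mul]
    rcases le_total 0 z with h | h
    · exact mul_nonneg (sub_nonneg.2 (hTm h)) h
    · exact mul_nonneg_of_nonpos_of_nonpos (sub_nonpos.2 (hTm h)) h
  change 0 < ∫ z, T z * z ∂(gaussianReal 0 1)
  rw [e]
  refine lt_of_le_of_ne (integral_nonneg hnn) fun h0 => ?_
  have hz := (integral_eq_zero_iff_of_nonneg hnn (i1.sub i2)).1 h0.symm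
  have hc : T =ᵐ[gaussianReal 0 1] fun _ => T 0 := by
    filter_upwards [hz] with z hz
    have hz' : (T z - T 0) * z = 0 := by
      rw [sub_mul]; exact hz
    rcases mul_eq_zero.1 hz' with h | h
    · linarith
    · rw [h]
  apply hnd (T 0)
  rw [← hTmap, Measure.map_congr hc, Measure.map_const]
  simp

theorem stmt6 (qt : Measure ℝ) [IsProbabilityMeasure qt]
    (hmom : Integrable (fun x => x ^ 2) qt)
    (hnd : ∀ x : ℝ, qt ≠ Measure.dirac x) :
    let μstar : ℝ := ∫ x, x ∂qt
    let σstar : ℝ := Real.sqrt 2 * ∫ y in (0:ℝ)..1, quantile qt y * erfinv (2 * y - 1)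
    0 < σstar ∧
      (∀ μ σ : ℝ, 0 < σ →
        Wpp 2 qt (gaussianReal μstar ((σstar ^ 2).toNNReal)) ≤
          Wpp 2 qt (gaussianReal μ ((σ ^ 2).toNNReal))) ∧
      (∀ μ σ : ℝ, 0 < σ →
        Wpp 2 qt (gaussianReal μ ((σ ^ 2).toNNReal)) =
          Wpp 2 qt (gaussianReal μstar ((σstar ^ 2).toNNReal)) →
        μ = μstar ∧ σ = σstar) := by
  intro μstar σstar
  have hS : ∫ z, quantile qt (Phi z) * z ∂(gaussianReal 0 1) = σstar := by
    simp only [σstar]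
    rw [change_var, ← integral_const_mul]
    congr 1
    ext z
    have := erfinv_Phi z
    calc quantile qt (Phi z) * z
        = quantile qt (Phi z) * (Real.sqrt 2 * erfinv (2 * Phi z - 1)) := by rw [this]
      _ = _ := by ring
  have hpos : 0 < σstar := hS ▸ S_pos qt hmom hnd
  have hF := Wpp_formula qt hmom
  rw [hS] at hF
  change ∀ m σ : ℝ, 0 < σ → Wpp 2 qt (gaussianReal m ((σ ^ 2).toNNReal)) =
      ∫ x, x ^ 2 ∂qt - 2 * m * μstar - 2 * σ * σstar + m ^ 2 + σ ^ 2 at hF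
  refine ⟨hpos, fun μ σ hσ => ?_, fun μ σ hσ h => ?_⟩
  · rw [hF _ _ hpos, hF _ _ hσ]
    nlinarith [sq_nonneg (μ - μstar), sq_nonneg (σ - σstar)]
  · rw [hF _ _ hpos, hF _ _ hσ] at h
    have h' : (μ - μstar) ^ 2 + (σ - σstar) ^ 2 = 0 := by linarith
    have a : (μ - μstar) ^ 2 = 0 := by nlinarith [sq_nonneg (μ - μstar), sq_nonneg (σ - σstar)]
    have b : (σ - σstar) ^ 2 = 0 := by nlinarith [sq_nonneg (μ - μstar), sq_nonneg (σ - σstar)]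
    exact ⟨sub_eq_zero.1 (pow_eq_zero_iff two_ne_zero |>.1 a),
      sub_eq_zero.1 (pow_eq_zero_iff two_ne_zero |>.1 b)⟩
end

section
/- Let q̃ be a probability measure on ℝ with finite second moment and variance σ²_EP, and let σ_QP = √2 ∫₀¹ F_{q̃}⁻¹(y) erf⁻¹(2y−1) dy. Then σ²_QP ≤ σ²_EP, with equality if and only if q̃ is Gaussian. -/
open MeasureTheory ProbabilityTheory Set

lemma quantile_le_iff_s8 (ξ : Measure ℝ) [IsProbabilityMeasure ξ] {y : ℝ} (hy : y ∈ Ioo (0:ℝ) 1)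
    (x : ℝ) : quantile ξ y ≤ x ↔ y ≤ (ξ (Iic x)).toReal := by
  have hF : ∀ x, (ξ (Iic x)).toReal = cdf ξ x := fun x => (cdf_eq_real ξ x).symm
  unfold quantile
  simp only [hF]
  have hbdd : BddBelow {x : ℝ | y ≤ cdf ξ x} := by
    obtain ⟨a, ha⟩ := ((tendsto_cdf_atBot ξ).eventually (gt_mem_nhds hy.1)).exists
    refine ⟨a, fun z hz => ?_⟩
    by_contra hlt
    push Not at hlt
    have := monotone_cdf ξ hlt.le
    have hz' : y ≤ cdf ξ z := hz
    linarith
  have hne : {x : ℝ | y ≤ cdf ξ x}.Nonempty := by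
    obtain ⟨a, ha⟩ := ((tendsto_cdf_atTop ξ).eventually (lt_mem_nhds hy.2)).exists
    exact ⟨a, ha.le⟩
  constructor
  · intro h
    have hc : ContinuousWithinAt (cdf ξ) (Ioi x) x :=
      ((cdf ξ).right_continuous x).mono Ioi_subset_Ici_self
    refine ge_of_tendsto hc ?_
    filter_upwards [self_mem_nhdsWithin] with z hz
    obtain ⟨w, hw, hwz⟩ := exists_lt_of_csInf_lt hne (lt_of_le_of_lt h hz)
    exact le_trans hw (monotone_cdf ξ hwz.le)
  · intro h
    exact csInf_le hbdd h

lemma quantile_monotoneOn (ξ : Measure ℝ) [IsProbabilityMeasure ξ] :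
    MonotoneOn (quantile ξ) (Ioo (0:ℝ) 1) := by
  intro a ha b hb hab
  rw [quantile_le_iff_s8 ξ ha]
  exact hab.trans ((quantile_le_iff_s8 ξ hb _).1 le_rfl)

lemma quantile_aemeasurable (ξ : Measure ℝ) [IsProbabilityMeasure ξ] :
    AEMeasurable (quantile ξ) (volume.restrict (Ioo (0:ℝ) 1)) :=
  aemeasurable_restrict_of_monotoneOn measurableSet_Ioo (quantile_monotoneOn ξ)

instance unif_prob : IsProbabilityMeasure (volume.restrict (Ioo (0:ℝ) 1)) :=
  ⟨by simp⟩

lemma map_quantile (ξ : Measure ℝ) [IsProbabilityMeasure ξ] :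
    (volume.restrict (Ioo (0:ℝ) 1)).map (quantile ξ) = ξ := by
  have := Measure.isProbabilityMeasure_map (quantile_aemeasurable ξ)
  refine Measure.ext_of_Iic _ _ fun x => ?_
  rw [Measure.map_apply_of_aemeasurable (quantile_aemeasurable ξ) measurableSet_Iic,
    Measure.restrict_apply₀' measurableSet_Ioo.nullMeasurableSet]
  have h1 : quantile ξ ⁻¹' Iic x ∩ Ioo 0 1 = Iic (ξ (Iic x)).toReal ∩ Ioo 0 1 := by
    ext y
    constructor
    · rintro ⟨h, hy⟩
      exact ⟨(quantile_le_iff_s8 ξ hy x).1 h, hy⟩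
    · rintro ⟨h, hy⟩
      exact ⟨(quantile_le_iff_s8 ξ hy x).2 h, hy⟩
  rw [h1]
  have h2 : volume (Iic (ξ (Iic x)).toReal ∩ Ioo (0:ℝ) 1)
      = volume (Iic (ξ (Iic x)).toReal ∩ Ioc (0:ℝ) 1) :=
    measure_congr ((Filter.EventuallyEq.refl _ _).inter Ioo_ae_eq_Ioc)
  have hle : (ξ (Iic x)).toReal ≤ 1 := by
    rw [← measureReal_def]; exact measureReal_le_one
  have h3 : Iic (ξ (Iic x)).toReal ∩ Ioc (0:ℝ) 1 = Ioc 0 (ξ (Iic x)).toReal := by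
    ext y
    simp only [mem_inter_iff, mem_Iic, mem_Ioc]
    constructor
    · rintro ⟨a, b, c⟩; exact ⟨b, a⟩
    · rintro ⟨a, b⟩; exact ⟨b, a, b.trans hle⟩
  rw [h2, h3, Real.volume_Ioc, sub_zero, ENNReal.ofReal_toReal (measure_ne_top _ _)]

lemma quantile_affine (ξ : Measure ℝ) [IsProbabilityMeasure ξ] (m c : ℝ) (hc : 0 ≤ c)
    {y : ℝ} (hy : y ∈ Ioo (0:ℝ) 1) :
    quantile (ξ.map (fun x => m + c * x)) y = m + c * quantile ξ y := by
  have hm : Measurable (fun x : ℝ => m + c * x) := by fun_prop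
  have := Measure.isProbabilityMeasure_map (μ := ξ) hm.aemeasurable
  refine eq_of_forall_ge_iff fun x => ?_
  rw [quantile_le_iff_s8 _ hy, Measure.map_apply hm measurableSet_Iic]
  rcases hc.eq_or_lt with rfl | hc
  · by_cases hx : m ≤ x
    · have : (fun x : ℝ => m + 0 * x) ⁻¹' Iic x = univ := by ext; simp [hx]
      rw [this]; simp [hx, hy.2.le]
    · have : (fun x : ℝ => m + 0 * x) ⁻¹' Iic x = ∅ := by ext; simpa using hx
      rw [this]; simp [hx, hy.1]
  · have : (fun x : ℝ => m + c * x) ⁻¹' Iic x = Iic ((x - m) / c) := by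
      ext z
      simp only [mem_preimage, mem_Iic]
      rw [le_div_iff₀ hc]
      constructor <;> intro h <;> linarith
    rw [this, ← quantile_le_iff_s8 _ hy, le_div_iff₀ hc]
    constructor <;> intro h <;> linarith

lemma erf_hasDerivAt (x : ℝ) :
    HasDerivAt erf ((2 / Real.sqrt Real.pi) * Real.exp (-x ^ 2)) x := by
  have hc : Continuous (fun t : ℝ => Real.exp (-t ^ 2)) := by fun_prop
  exact ((hc.integral_hasStrictDerivAt 0 x).hasDerivAt).const_mul _

lemma erf_continuous : Continuous erf :=
  continuous_iff_continuousAt.2 fun x => (erf_hasDerivAt x).continuousAt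

lemma gaussian_cdf (x : ℝ) : (gaussianReal 0 2⁻¹ (Iic x)).toReal = (1 + erf x) / 2 := by
  have hpdf : gaussianPDFReal 0 2⁻¹ = fun t : ℝ => (Real.sqrt Real.pi)⁻¹ * Real.exp (-t ^ 2) := by
    ext t
    simp [gaussianPDFReal]
    field_simp
  have hint : Integrable (fun t : ℝ => Real.exp (-t ^ 2)) := by
    simpa using integrable_exp_neg_mul_sq (b := 1) one_pos
  have h0 : ∫ t in Iic (0:ℝ), Real.exp (-t ^ 2) = Real.sqrt Real.pi / 2 := by
    have h1 := integral_comp_neg_Iic (0:ℝ) (fun t : ℝ => Real.exp (-t ^ 2))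
    have h2 := integral_gaussian_Ioi 1
    simp only [neg_sq, neg_zero] at h1
    rw [h1]
    simpa using h2
  have hsub := intervalIntegral.integral_Iic_sub_Iic (a := 0) (b := x) (μ := volume)
    (f := fun t : ℝ => Real.exp (-t ^ 2)) hint.integrableOn hint.integrableOn
  rw [gaussianReal_apply_eq_integral _ (by norm_num), ENNReal.toReal_ofReal
    (integral_nonneg fun t => gaussianPDFReal_nonneg _ _ _), hpdf, integral_const_mul]
  unfold erf
  rw [← hsub, h0]
  have : Real.sqrt Real.pi ≠ 0 := (Real.sqrt_pos.2 Real.pi_pos).ne'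
  field_simp
  ring

lemma erf_erfinv {y : ℝ} (hy : y ∈ Ioo (0:ℝ) 1) : erf (erfinv (2 * y - 1)) = 2 * y - 1 := by
  have hF : ∀ x, cdf (gaussianReal 0 2⁻¹) x = (1 + erf x) / 2 := fun x => by
    rw [cdf_eq_real, measureReal_def, gaussian_cdf]
  obtain ⟨a, ha⟩ := ((tendsto_cdf_atBot (gaussianReal 0 2⁻¹)).eventually
    (gt_mem_nhds hy.1)).exists
  obtain ⟨b, hb⟩ := ((tendsto_cdf_atTop (gaussianReal 0 2⁻¹)).eventually
    (lt_mem_nhds hy.2)).exists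
  rw [hF] at ha hb
  have := mem_range_of_exists_le_of_exists_ge erf_continuous (c := 2 * y - 1)
    ⟨a, by linarith⟩ ⟨b, by linarith⟩
  exact Function.invFun_eq this

lemma quantile_gaussian {y : ℝ} (hy : y ∈ Ioo (0:ℝ) 1) :
    quantile (gaussianReal 0 2⁻¹) y = erfinv (2 * y - 1) := by
  refine eq_of_forall_ge_iff fun x => ?_
  rw [quantile_le_iff_s8 _ hy, gaussian_cdf, 
    ← erf_strictMono.le_iff_le (a := erfinv (2 * y - 1)), erf_erfinv hy]
  constructor <;> intro h <;> linarith

lemma gaussian_affine (m c : ℝ) : (gaussianReal 0 2⁻¹).map (fun x => m + c * x)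
    = gaussianReal m (.mk (c ^ 2) (sq_nonneg _) * 2⁻¹) := by
  have h1 := gaussianReal_map_const_mul (μ := 0) (v := 2⁻¹) c
  have h2 := gaussianReal_map_const_add (μ := 0) (v := .mk (c ^ 2) (sq_nonneg _) * 2⁻¹) m
  rw [mul_zero] at h1
  rw [← h1, Measure.map_map (by fun_prop) (by fun_prop), zero_add] at h2
  exact h2


/-- `σ²_QP ≤ σ²_EP`, with equality iff `q̃` is Gaussian. -/
theorem stmt8 (qt : Measure ℝ) [IsProbabilityMeasure qt]
    (hmom : Integrable (fun x => x ^ 2) qt) :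
    let σQP : ℝ := Real.sqrt 2 * ∫ y in (0:ℝ)..1, quantile qt y * erfinv (2 * y - 1)
    σQP ^ 2 ≤ ProbabilityTheory.variance id qt ∧
      (σQP ^ 2 = ProbabilityTheory.variance id qt ↔
        ∃ (m : ℝ) (v : NNReal), qt = gaussianReal m v) := by
  intro σQP
  set U : Measure ℝ := volume.restrict (Ioo (0:ℝ) 1) with hU
  set ν : Measure ℝ := gaussianReal 0 2⁻¹ with hν
  set Q := quantile qt
  set G := quantile ν
  have hQm : AEMeasurable Q U := quantile_aemeasurable qt
  have hGm : AEMeasurable G U := quantile_aemeasurable ν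
  have hQmap : U.map Q = qt := map_quantile qt
  have hGmap : U.map G = ν := map_quantile ν
  have hσ : σQP = Real.sqrt 2 * ∫ y, Q y * G y ∂U := by
    simp only [σQP]
    rw [intervalIntegral.integral_of_le zero_le_one, integral_Ioc_eq_integral_Ioo]
    congr 1
    refine setIntegral_congr_fun measurableSet_Ioo fun y hy => ?_
    simp only [G, Q, hν, quantile_gaussian hy]
  have hid : MemLp id 2 qt := (memLp_two_iff_integrable_sq (by fun_prop)).2 hmom
  have hidν : MemLp id 2 ν := memLp_id_gaussianReal 2
  have hQ2 : MemLp Q 2 U := by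
    rw [← hQmap] at hid
    exact (memLp_map_measure_iff (by fun_prop) hQm).1 hid
  have hG2 : MemLp G 2 U := by
    rw [← hGmap] at hidν
    exact (memLp_map_measure_iff (by fun_prop) hGm).1 hidν
  have hvQ : variance id qt = variance Q U := by
    rw [← hQmap, variance_map (by fun_prop) hQm]; rfl
  have hvG : variance G U = 1 / 2 := by
    have : variance id ν = variance G U := by
      rw [← hGmap, variance_map (by fun_prop) hGm]; rfl
    rw [← this, hν, variance_id_gaussianReal]; simp
  have heG : ∫ y, G y ∂U = 0 := by
    have : ∫ x, x ∂ν = ∫ y, G y ∂U := by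
      rw [← hGmap, integral_map hGm (by fun_prop)]
    rw [← this, hν, integral_id_gaussianReal]
  have hQi := hQ2.integrable one_le_two
  have hGi := hG2.integrable one_le_two
  have hQG : Integrable (fun y => Q y * G y) U := hQ2.integrable_mul hG2
  have hQQ := hQ2.integrable_sq
  have hGG := hG2.integrable_sq
  have hvG' : ∫ y, G y ^ 2 ∂U = 1 / 2 := by
    rw [variance_eq_sub hG2, heG] at hvG
    simpa using hvG
  set m := ∫ y, Q y ∂U with hm
  set s := σQP
  set c := Real.sqrt 2 * s with hc
  have hs2 : Real.sqrt 2 ^ 2 = 2 := Real.sq_sqrt (by norm_num)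
  have key : ∀ c : ℝ, ∫ y, (Q y - (m + c * G y)) ^ 2 ∂U
      = variance Q U - 2 * c * (∫ y, Q y * G y ∂U) + c ^ 2 / 2 := by
    intro c
    have e : ∀ y, (Q y - (m + c * G y)) ^ 2 = Q y ^ 2 - 2 * m * Q y + m ^ 2
        - 2 * c * (Q y * G y) + c ^ 2 * G y ^ 2 + 2 * m * c * G y := fun y => by ring
    simp only [e]
    rw [integral_add (by fun_prop) (by fun_prop), integral_add (by fun_prop) (by fun_prop),
      integral_sub (by fun_prop) (by fun_prop), integral_add (by fun_prop) (by fun_prop),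
      integral_sub (by fun_prop) (by fun_prop)]
    simp only [integral_const_mul, heG, hvG', ← hm]
    rw [variance_eq_sub hQ2]
    simp [← hm]
    ring
  have hkey : ∫ y, (Q y - (m + c * G y)) ^ 2 ∂U = variance Q U - s ^ 2 := by
    rw [key]
    have h2 : c * (∫ y, Q y * G y ∂U) = s ^ 2 := by
      rw [hc, sq, hσ]; ring
    have h3 : c ^ 2 = 2 * s ^ 2 := by rw [hc, mul_pow, hs2]
    rw [h3, mul_assoc, h2]; ring
  have hnn : 0 ≤ ∫ y, (Q y - (m + c * G y)) ^ 2 ∂U := integral_nonneg fun y => sq_nonneg _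
  rw [hvQ]
  refine ⟨by linarith, fun h => ?_, ?_⟩
  · have hz : ∫ y, (Q y - (m + c * G y)) ^ 2 ∂U = 0 := by rw [hkey, h]; ring
    have hmem : MemLp (fun y => Q y - (m + c * G y)) 2 U :=
      hQ2.sub ((memLp_const m).add (hG2.const_mul c))
    rw [integral_eq_zero_iff_of_nonneg (fun y => sq_nonneg _) hmem.integrable_sq] at hz
    have hae : Q =ᵐ[U] (fun x => m + c * x) ∘ G := by
      filter_upwards [hz] with y hy
      have : Q y - (m + c * G y) = 0 := by simpa using hy
      simp only [Function.comp]; linarith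
    refine ⟨m, .mk (c ^ 2) (sq_nonneg _) * 2⁻¹, ?_⟩
    rw [← gaussian_affine, ← hν, ← hGmap, AEMeasurable.map_map_of_aemeasurable (by fun_prop) hGm,
      ← Measure.map_congr hae, hQmap]
  · rintro ⟨a, v, hv⟩
    set d := Real.sqrt (2 * v) with hd
    have hd2 : d ^ 2 = 2 * v := Real.sq_sqrt (by positivity)
    have hqt : qt = ν.map (fun x => a + d * x) := by
      rw [hν, gaussian_affine, hv]
      congr 1
      ext
      simp [hd2]
      ring
    have hQeq : ∫ y, Q y * G y ∂U = ∫ y, (a * G y + d * G y ^ 2) ∂U := by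
      refine setIntegral_congr_fun measurableSet_Ioo fun y hy => ?_
      have : Q y = a + d * G y := by
        simp only [Q, G]
        rw [hqt]
        exact quantile_affine ν a d (Real.sqrt_nonneg _) hy
      simp only [this]; ring
    rw [integral_add (by fun_prop) (by fun_prop), integral_const_mul, integral_const_mul,
      heG, hvG'] at hQeq
    rw [← hvQ, hv, variance_id_gaussianReal, hσ, hQeq, mul_pow, hs2]
    linear_combination hd2 / 2
end
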